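/- Let A be a real m×n matrix (m ≥ n) of full rank n with nonzero rows a_1,…,a_m, let x ∈ ℝⁿ with A x = b, and let σ_min > 0 denote the smallest singular value of A. Let (x_k)_{k≥0} be the randomized Kaczmarz iteration for A x = b started at an arbitrary x_0 ∈ ℝⁿ, where at each step row i is chosen independently with probability ‖a_i‖²/‖A‖_F². Then for every k ≥ 0, 𝔼 ‖x_k − x‖² ≤ (1 − σ_min²/‖A‖_F²)^k · ‖x_0 − x‖². -/

import Mathlib

open scoped BigOperators RealInnerProductSpace Matrix

noncomputable section

/-- The `i`-th row of the matrix `A`, viewed as a vector in Euclidean space `ℝⁿ`. -/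
def kacRow {m n : ℕ} (A : Matrix (Fin m) (Fin n) ℝ) (i : Fin m) :
    EuclideanSpace ℝ (Fin n) :=
  (EuclideanSpace.equiv (Fin n) ℝ).symm (A i)

/-- The squared Frobenius norm of `A`: `‖A‖_F² = ∑ i ‖a i‖²` where `a i` are the rows. -/
def frob2 {m n : ℕ} (A : Matrix (Fin m) (Fin n) ℝ) : ℝ :=
  ∑ i, ‖kacRow A i‖ ^ 2

/-- The matrix `A` acting on `y ∈ ℝⁿ`, viewed as a vector in Euclidean space `ℝᵐ`. -/
def mulE {m n : ℕ} (A : Matrix (Fin m) (Fin n) ℝ) (y : EuclideanSpace ℝ (Fin n)) :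
    EuclideanSpace ℝ (Fin m) :=
  (EuclideanSpace.equiv (Fin m) ℝ).symm (A *ᵥ (EuclideanSpace.equiv (Fin n) ℝ y))

/-- One Kaczmarz step for the system `A z = b` using the `i`-th equation:
`z ↦ z + ((b i - ⟪a i, z⟫)/‖a i‖²) • a i`. -/
def kacStep {m n : ℕ} (A : Matrix (Fin m) (Fin n) ℝ) (b : Fin m → ℝ) (i : Fin m)
    (z : EuclideanSpace ℝ (Fin n)) : EuclideanSpace ℝ (Fin n) :=
  z + ((b i - ⟪kacRow A i, z⟫) / ‖kacRow A i‖ ^ 2) • kacRow A i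

/-- The Kaczmarz iterate `x_k` obtained from the starting point `x0` by successively
applying the steps with rows `ω 0, ω 1, …, ω (k-1)`. -/
def kacPath {m n : ℕ} (A : Matrix (Fin m) (Fin n) ℝ) (b : Fin m → ℝ)
    (x0 : EuclideanSpace ℝ (Fin n)) (k : ℕ) (ω : Fin k → Fin m) :
    EuclideanSpace ℝ (Fin n) :=
  (List.ofFn ω).foldl (fun z i => kacStep A b i z) x0

/-- The squared norm of `A y` is the sum of the squared inner products with the rows. -/
lemma norm_mulE_sq {m n : ℕ} (A : Matrix (Fin m) (Fin n) ℝ) (y : EuclideanSpace ℝ (Fin n)) :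
    ‖mulE A y‖ ^ 2 = ∑ i, ⟪kacRow A i, y⟫ ^ 2 := by
  rw [EuclideanSpace.norm_sq_eq]
  refine Finset.sum_congr rfl fun i _ => ?_
  simp [mulE, kacRow, Matrix.mulVec, dotProduct, PiLp.inner_apply, mul_comm]

lemma norm_mulE_sq_le {m n : ℕ} (A : Matrix (Fin m) (Fin n) ℝ) (y : EuclideanSpace ℝ (Fin n)) :
    ‖mulE A y‖ ^ 2 ≤ frob2 A * ‖y‖ ^ 2 := by
  rw [norm_mulE_sq, frob2, Finset.sum_mul]
  refine Finset.sum_le_sum fun i _ => ?_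
  rw [← mul_pow, ← sq_abs]
  exact pow_le_pow_left₀ (abs_nonneg _) (abs_real_inner_le_norm _ _) 2

/-- The Kaczmarz step is an orthogonal projection, so the error obeys Pythagoras' theorem. -/
lemma norm_kacStep_sub_sq {m n : ℕ} (A : Matrix (Fin m) (Fin n) ℝ) (b : Fin m → ℝ) (i : Fin m)
    (x z : EuclideanSpace ℝ (Fin n)) (hai : kacRow A i ≠ 0) (hbi : b i = ⟪kacRow A i, x⟫) :
    ‖kacRow A i‖ ^ 2 * ‖kacStep A b i z - x‖ ^ 2 =
      ‖kacRow A i‖ ^ 2 * ‖z - x‖ ^ 2 - ⟪kacRow A i, z - x⟫ ^ 2 := by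
  have hne : ‖kacRow A i‖ ≠ 0 := norm_ne_zero_iff.mpr hai
  have hstep : kacStep A b i z - x =
      (z - x) - (⟪kacRow A i, z - x⟫ / ‖kacRow A i‖ ^ 2) • kacRow A i := by
    rw [kacStep, hbi, ← inner_sub_right, ← neg_sub z x, inner_neg_right, neg_div, neg_smul]
    abel
  rw [hstep, norm_sub_sq_real, inner_smul_right, norm_smul, mul_pow, Real.norm_eq_abs, sq_abs,
    real_inner_comm]
  field_simp
  ring

lemma kacPath_cons {m n : ℕ} (A : Matrix (Fin m) (Fin n) ℝ) (b : Fin m → ℝ)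
    (x0 : EuclideanSpace ℝ (Fin n)) (k : ℕ) (i : Fin m) (ω : Fin k → Fin m) :
    kacPath A b x0 (k + 1) (Fin.cons i ω) = kacPath A b (kacStep A b i x0) k ω := by
  simp [kacPath, List.ofFn_succ]

lemma sum_fin_succ_pi {α M : Type*} [Fintype α] [AddCommMonoid M] (k : ℕ)
    (f : (Fin (k + 1) → α) → M) :
    ∑ ω, f ω = ∑ i, ∑ ω : Fin k → α, f (Fin.cons i ω) := by
  rw [← Fintype.sum_prod_type']
  exact ((Fin.consEquiv fun _ : Fin (k + 1) => α).sum_comp f).symm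

/-- One step of randomized Kaczmarz contracts the expected squared error. -/
lemma sum_norm_kacStep_sub_sq_le {m n : ℕ} (A : Matrix (Fin m) (Fin n) ℝ) (b : Fin m → ℝ)
    (x z : EuclideanSpace ℝ (Fin n)) (ha : ∀ i, kacRow A i ≠ 0)
    (hb : ∀ i, b i = ⟪kacRow A i, x⟫) (hF : 0 < frob2 A) {σ : ℝ} (hσ : 0 ≤ σ)
    (hσ_le : ∀ y : EuclideanSpace ℝ (Fin n), σ * ‖y‖ ≤ ‖mulE A y‖) :
    ∑ i, ‖kacRow A i‖ ^ 2 / frob2 A * ‖kacStep A b i z - x‖ ^ 2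
      ≤ (1 - σ ^ 2 / frob2 A) * ‖z - x‖ ^ 2 := by
  have hsum : ∑ i, ‖kacRow A i‖ ^ 2 / frob2 A * ‖kacStep A b i z - x‖ ^ 2 =
      (frob2 A * ‖z - x‖ ^ 2 - ‖mulE A (z - x)‖ ^ 2) / frob2 A := by
    rw [norm_mulE_sq]
    nth_rw 2 [frob2]
    rw [Finset.sum_mul, ← Finset.sum_sub_distrib, Finset.sum_div]
    refine Finset.sum_congr rfl fun i _ => ?_
    rw [← norm_kacStep_sub_sq A b i x z (ha i) (hb i)]
    ring
  have hsq : σ ^ 2 * ‖z - x‖ ^ 2 ≤ ‖mulE A (z - x)‖ ^ 2 := by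
    rw [← mul_pow]
    exact pow_le_pow_left₀ (by positivity) (hσ_le _) 2
  rw [hsum, div_le_iff₀ hF]
  field_simp
  linarith

/-- **Strohmer–Vershynin convergence rate of randomized Kaczmarz.**
Let `A` be an `m × n` real matrix (`m ≥ n`) of full rank `n` with nonzero rows, let
`A x = b`, and let `σmin > 0` be the smallest singular value of `A`, i.e.
`‖A y‖ ≥ σmin ‖y‖` for all `y` and `‖A v‖ = σmin` for some unit vector `v`.
Run the randomized Kaczmarz iteration from `x0`, choosing at each step row `i`
independently with probability `‖a i‖²/‖A‖_F²`; the expectation over the first `k`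
choices is the sum over all paths `ω : Fin k → Fin m` weighted by
`∏ t, ‖a (ω t)‖²/‖A‖_F²`.  Then `𝔼 ‖x_k - x‖² ≤ (1 - σmin²/‖A‖_F²)^k ‖x0 - x‖²`. -/
theorem randomized_kaczmarz_strohmer_vershynin_rate {m n : ℕ}
    (hmn : n ≤ m) (A : Matrix (Fin m) (Fin n) ℝ)
    (hrank : A.rank = n) (ha : ∀ i, kacRow A i ≠ 0)
    (σmin : ℝ) (hσpos : 0 < σmin)
    (hσ_le : ∀ y : EuclideanSpace ℝ (Fin n), σmin * ‖y‖ ≤ ‖mulE A y‖)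
    (hσ_attained : ∃ v : EuclideanSpace ℝ (Fin n), ‖v‖ = 1 ∧ ‖mulE A v‖ = σmin)
    (x : EuclideanSpace ℝ (Fin n)) (b : Fin m → ℝ)
    (hb : ∀ i, b i = ⟪kacRow A i, x⟫)
    (x0 : EuclideanSpace ℝ (Fin n)) (k : ℕ) :
    ∑ ω : Fin k → Fin m,
        (∏ t : Fin k, ‖kacRow A (ω t)‖ ^ 2 / frob2 A) * ‖kacPath A b x0 k ω - x‖ ^ 2
      ≤ (1 - σmin ^ 2 / frob2 A) ^ k * ‖x0 - x‖ ^ 2 := by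
  obtain ⟨v, hv, hAv⟩ := hσ_attained
  have hσF : σmin ^ 2 ≤ frob2 A := by
    simpa [hv, hAv] using norm_mulE_sq_le A v
  have hF : 0 < frob2 A := lt_of_lt_of_le (by positivity) hσF
  have hrate : 0 ≤ 1 - σmin ^ 2 / frob2 A :=
    sub_nonneg.mpr ((div_le_one hF).mpr hσF)
  induction k generalizing x0 with
  | zero => simp [kacPath]
  | succ k ih =>
    rw [sum_fin_succ_pi]
    simp only [kacPath_cons, Fin.prod_univ_succ, Fin.cons_zero,
      Fin.cons_succ, mul_assoc, ← Finset.mul_sum]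
    calc _ ≤ ∑ i, ‖kacRow A i‖ ^ 2 / frob2 A *
          ((1 - σmin ^ 2 / frob2 A) ^ k * ‖kacStep A b i x0 - x‖ ^ 2) := by
          gcongr with i
          exact ih _
      _ = (1 - σmin ^ 2 / frob2 A) ^ k *
          ∑ i, ‖kacRow A i‖ ^ 2 / frob2 A * ‖kacStep A b i x0 - x‖ ^ 2 := by
          rw [Finset.mul_sum]
          exact Finset.sum_congr rfl fun i _ => mul_left_comm _ _ _
      _ ≤ (1 - σmin ^ 2 / frob2 A) ^ k * ((1 - σmin ^ 2 / frob2 A) * ‖x0 - x‖ ^ 2) := by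
          gcongr
          exact sum_norm_kacStep_sub_sq_le A b x x0 ha hb hF hσpos.le hσ_le
      _ = _ := by rw [pow_succ _ k, mul_assoc]
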